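/- Let f, g ∈ F[Y ∪ Z]. If g can be expressed as g = Σ_{i=1}^r g_i·h_i where each g_i ∈ F[Y] uses only Y-variables and each h_i ∈ F[Z] uses only Z-variables, then maxrank(M_{fg}) ≤ r · maxrank(M_f). -/

import Mathlib

open scoped Classical

noncomputable section

namespace PCM

variable {F : Type} [Field F] {Y Z : Type} [Fintype Y] [Fintype Z]

/-- Exponent vector of the monic multilinear monomial `∏_{y ∈ p} y · ∏_{z ∈ q} z`. -/
def mexp (p : Finset Y) (q : Finset Z) : (Y ⊕ Z) →₀ ℕ :=
  (∑ y ∈ p, Finsupp.single (Sum.inl y) 1) + ∑ z ∈ q, Finsupp.single (Sum.inr z) 1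

/-- The polynomial coefficient matrix `M_f`. -/
def coeffMatrix (f : MvPolynomial (Y ⊕ Z) F) :
    Matrix (Finset Y) (Finset Z) (MvPolynomial (Y ⊕ Z) F) := fun p q =>
  ∑ d ∈ f.support,
    if d.support ⊆ p.image Sum.inl ∪ q.image Sum.inr ∧ mexp p q ≤ d then
      MvPolynomial.monomial (d - mexp p q) (MvPolynomial.coeff d f)
    else 0

/-- `maxrank(M_f)`: the maximum, over substitutions `S`, of the rank of `M_f|_S`. -/
def maxrank (f : MvPolynomial (Y ⊕ Z) F) : ℕ :=
  ⨆ S : (Y ⊕ Z) → F, ((coeffMatrix f).map (MvPolynomial.eval S)).rank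

/-- The partial derivatives matrix `L_f`. -/
def pdMatrix (f : MvPolynomial (Y ⊕ Z) F) : Matrix (Finset Y) (Finset Z) F := fun p q =>
  MvPolynomial.coeff (mexp p q) f

end PCM

namespace PCM

/-- The local factor at the variable `v` of `weight S T d`. -/
def localWeight {F V : Type} [Field F] (S : V → F) (T : Finset V) (d : V →₀ ℕ) (v : V) : F :=
  if v ∈ T then (if d v = 0 then 0 else S v ^ (d v - 1)) else if d v = 0 then 1 else 0

/-- The value at `S` of the coefficient contributed by the exponent vector `d` to the entry of the
polynomial coefficient matrix at the set of variables `T`, as a product of local factors. -/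
def weight {F V : Type} [Field F] [Fintype V] (S : V → F) (T : Finset V) (d : V →₀ ℕ) : F :=
  ∏ v, localWeight S T d v

/-- The linear functional on polynomials with value `weight S T d` on the monomial `d`. -/
def entry {F V : Type} [Field F] [Fintype V] (S : V → F) (T : Finset V) :
    MvPolynomial V F →ₗ[F] F :=
  (MvPolynomial.basisMonomials V F).constr F (weight S T)

section

variable {F V : Type} [Field F] [Fintype V]

theorem entry_apply (S : V → F) (T : Finset V) (f : MvPolynomial V F) :
    entry S T f = ∑ d ∈ f.support, MvPolynomial.coeff d f * weight S T d := by
  unfold entry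
  rw [Module.Basis.constr_apply]
  rfl

theorem entry_monomial (S : V → F) (T : Finset V) (d : V →₀ ℕ) :
    entry S T (MvPolynomial.monomial d 1) = weight S T d := by
  have h := (MvPolynomial.basisMonomials V F).constr_basis F (weight S T) d
  rwa [MvPolynomial.coe_basisMonomials] at h

theorem weight_add_single [DecidableEq V] (S : V → F) (T : Finset V) (d : V →₀ ℕ) (v : V) :
    weight S T (d + Finsupp.single v 1) =
      if v ∈ T then weight S (T.erase v) d + S v * weight S T d else 0 := by
  unfold weight
  simp only [← Finset.mul_prod_erase Finset.univ _ (Finset.mem_univ v)]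
  have h1 : ∀ u ∈ Finset.univ.erase v,
      localWeight S T (d + Finsupp.single v 1) u = localWeight S T d u := by
    intro u hu
    simp [localWeight, (Finset.ne_of_mem_erase hu).symm]
  have h2 : ∀ u ∈ Finset.univ.erase v, localWeight S (T.erase v) d u = localWeight S T d u := by
    intro u hu
    simp [localWeight, Finset.ne_of_mem_erase hu]
  rw [Finset.prod_congr rfl h1, Finset.prod_congr rfl h2]
  generalize ∏ u ∈ Finset.univ.erase v, localWeight S T d u = P
  by_cases hv : v ∈ T
  · rcases hd : d v with _ | n
    · simp [localWeight, hv, hd]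
    · simp [localWeight, hv, hd, pow_succ']
      ring
  · simp [localWeight, hv]

theorem entry_mul_X [DecidableEq V] (S : V → F) (T : Finset V) (f : MvPolynomial V F) (v : V) :
    entry S T (f * MvPolynomial.X v) =
      if v ∈ T then entry S (T.erase v) f + S v * entry S T f else 0 := by
  have h : entry S T ∘ₗ LinearMap.mulRight F (MvPolynomial.X v) =
      if v ∈ T then entry S (T.erase v) + S v • entry S T else 0 := by
    refine (MvPolynomial.basisMonomials V F).ext fun d => ?_
    rw [MvPolynomial.coe_basisMonomials, LinearMap.comp_apply, LinearMap.mulRight_apply,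
      MvPolynomial.X, MvPolynomial.monomial_mul, mul_one, entry_monomial, weight_add_single]
    split_ifs <;> simp [entry_monomial]
  have := LinearMap.congr_fun h f
  split_ifs at this ⊢ <;> simpa using this

end

variable {F : Type} [Field F] {Y Z : Type} [Fintype Y] [Fintype Z]

theorem mexp_apply {A B : Type} (p : Finset A) (q : Finset B) (v : A ⊕ B) :
    mexp p q v = if v ∈ p.disjSum q then 1 else 0 := by
  rcases v with y | z <;> simp [mexp, Finsupp.single_apply]

theorem eval_coeffMatrix (S : Y ⊕ Z → F) (f : MvPolynomial (Y ⊕ Z) F) (p : Finset Y)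
    (q : Finset Z) :
    MvPolynomial.eval S (coeffMatrix f p q) = entry S (p.disjSum q) f := by
  have hT : p.image Sum.inl ∪ q.image Sum.inr = p.disjSum q := by
    ext (y | z) <;> simp
  rw [entry_apply, coeffMatrix, map_sum]
  refine Finset.sum_congr rfl fun d _ => ?_
  rw [hT]
  split_ifs with h
  · rw [MvPolynomial.eval_monomial, Finsupp.prod_fintype _ _ (by simp), weight]
    congr 1
    refine Finset.prod_congr rfl fun v _ => ?_
    have hle := h.2 v
    rw [mexp_apply] at hle
    rw [Finsupp.tsub_apply, mexp_apply]
    by_cases hv : v ∈ p.disjSum q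
    · have : d v ≠ 0 := by simp only [hv, if_true] at hle; omega
      simp only [localWeight, hv, this, if_true, if_false]
    · have : d v = 0 := by
        by_contra h0
        exact hv (h.1 (Finsupp.mem_support_iff.2 h0))
      simp [localWeight, hv, this]
  · rw [map_zero, weight, eq_comm, mul_eq_zero]
    right
    rw [Finset.prod_eq_zero_iff]
    by_contra hne
    push Not at hne
    refine h ⟨fun v hv => ?_, fun v => ?_⟩
    · by_contra hvT
      exact hne v (Finset.mem_univ v) (by simp [localWeight, hvT, Finsupp.mem_support_iff.1 hv])
    · rw [mexp_apply]
      split_ifs with hvT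
      · by_contra h0
        exact hne v (Finset.mem_univ v) (by simp [localWeight, hvT, show d v = 0 by omega])
      · exact Nat.zero_le _

/-- The matrix `M_f|_S` as a linear function of `f`. -/
def evalMatrix (S : Y ⊕ Z → F) : MvPolynomial (Y ⊕ Z) F →ₗ[F] Matrix (Finset Y) (Finset Z) F where
  toFun f := (coeffMatrix f).map (MvPolynomial.eval S)
  map_add' f g := by ext p q; simp [eval_coeffMatrix]
  map_smul' c f := by ext p q; simp [eval_coeffMatrix]

theorem evalMatrix_apply (S : Y ⊕ Z → F) (f : MvPolynomial (Y ⊕ Z) F) (p : Finset Y)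
    (q : Finset Z) : evalMatrix S f p q = entry S (p.disjSum q) f :=
  eval_coeffMatrix S f p q

theorem exists_evalMatrix_mul_left (S : Y ⊕ Z → F) (g : MvPolynomial (Y ⊕ Z) F)
    (hg : ∀ v ∈ g.vars, v.isLeft = true) :
    ∃ R : Matrix (Finset Y) (Finset Y) F, ∀ f, evalMatrix S (f * g) = R * evalMatrix S f := by
  have hmem : g ∈ MvPolynomial.supported F {v : Y ⊕ Z | v.isLeft = true} :=
    MvPolynomial.mem_supported.2 hg
  rw [MvPolynomial.supported] at hmem
  clear hg
  induction hmem using Algebra.adjoin_induction with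
  | mem x hx =>
    obtain ⟨v, hv, rfl⟩ := hx
    obtain ⟨y, rfl⟩ := Sum.isLeft_iff.1 hv
    refine ⟨Matrix.of fun p p' => if y ∈ p then
      (if p.erase y = p' then 1 else 0) + S (Sum.inl y) * (if p = p' then 1 else 0) else 0,
      fun f => ?_⟩
    ext p q
    have he : (p.disjSum q).erase (Sum.inl y) = (p.erase y).disjSum q := by
      ext (a | b) <;> simp
    rw [evalMatrix_apply, entry_mul_X, he, Matrix.mul_apply]
    by_cases hy : y ∈ p <;> simp [hy, add_mul, Finset.sum_add_distrib, evalMatrix_apply]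
  | algebraMap c =>
    refine ⟨c • 1, fun f => ?_⟩
    rw [mul_comm, ← Algebra.smul_def, map_smul, Matrix.smul_mul, Matrix.one_mul]
  | add a b _ _ ha hb =>
    obtain ⟨A, hA⟩ := ha
    obtain ⟨B, hB⟩ := hb
    exact ⟨A + B, fun f => by rw [mul_add, map_add, hA, hB, Matrix.add_mul]⟩
  | mul a b _ _ ha hb =>
    obtain ⟨A, hA⟩ := ha
    obtain ⟨B, hB⟩ := hb
    exact ⟨B * A, fun f => by rw [← mul_assoc, hB, hA, Matrix.mul_assoc]⟩

theorem exists_evalMatrix_mul_right (S : Y ⊕ Z → F) (g : MvPolynomial (Y ⊕ Z) F)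
    (hg : ∀ v ∈ g.vars, v.isRight = true) :
    ∃ C : Matrix (Finset Z) (Finset Z) F, ∀ f, evalMatrix S (f * g) = evalMatrix S f * C := by
  have hmem : g ∈ MvPolynomial.supported F {v : Y ⊕ Z | v.isRight = true} :=
    MvPolynomial.mem_supported.2 hg
  rw [MvPolynomial.supported] at hmem
  clear hg
  induction hmem using Algebra.adjoin_induction with
  | mem x hx =>
    obtain ⟨v, hv, rfl⟩ := hx
    obtain ⟨z, rfl⟩ := Sum.isRight_iff.1 hv
    refine ⟨Matrix.of fun q' q => if z ∈ q then
      (if q.erase z = q' then 1 else 0) + S (Sum.inr z) * (if q = q' then 1 else 0) else 0,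
      fun f => ?_⟩
    ext p q
    have he : (p.disjSum q).erase (Sum.inr z) = p.disjSum (q.erase z) := by
      ext (a | b) <;> simp
    rw [evalMatrix_apply, entry_mul_X, he, Matrix.mul_apply]
    by_cases hz : z ∈ q <;>
      simp [hz, mul_add, Finset.sum_add_distrib, evalMatrix_apply, mul_comm (S _)]
  | algebraMap c =>
    refine ⟨c • 1, fun f => ?_⟩
    rw [mul_comm, ← Algebra.smul_def, map_smul, Matrix.mul_smul, Matrix.mul_one]
  | add a b _ _ ha hb =>
    obtain ⟨A, hA⟩ := ha
    obtain ⟨B, hB⟩ := hb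
    exact ⟨A + B, fun f => by rw [mul_add, map_add, hA, hB, Matrix.mul_add]⟩
  | mul a b _ _ ha hb =>
    obtain ⟨A, hA⟩ := ha
    obtain ⟨B, hB⟩ := hb
    exact ⟨A * B, fun f => by rw [← mul_assoc, hB, hA, Matrix.mul_assoc]⟩

theorem rank_add_le {m n : Type} [Fintype m] [Fintype n] (A B : Matrix m n F) :
    (A + B).rank ≤ A.rank + B.rank := by
  unfold Matrix.rank
  rw [Matrix.mulVecLin_add]
  exact (Submodule.finrank_mono (LinearMap.range_add_le _ _)).trans
    (Submodule.finrank_add_le_finrank_add_finrank _ _)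

theorem rank_sum_le {ι m n : Type} [Fintype m] [Fintype n] (s : Finset ι)
    (A : ι → Matrix m n F) : (∑ i ∈ s, A i).rank ≤ ∑ i ∈ s, (A i).rank := by
  induction s using Finset.induction_on with
  | empty => simp
  | insert a s ha ih =>
    rw [Finset.sum_insert ha, Finset.sum_insert ha]
    exact (rank_add_le _ _).trans (Nat.add_le_add_left ih _)

theorem rank_evalMatrix_le_maxrank (S : Y ⊕ Z → F) (f : MvPolynomial (Y ⊕ Z) F) :
    (evalMatrix S f).rank ≤ maxrank f :=
  le_ciSup (f := fun S : Y ⊕ Z → F => ((coeffMatrix f).map (MvPolynomial.eval S)).rank)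
    ⟨Fintype.card (Finset Z), by rintro _ ⟨S, rfl⟩; exact Matrix.rank_le_card_width _⟩ S

end PCM

/-- if `g = Σ_{i=1}^r gᵢ·hᵢ` with each `gᵢ` using only `Y`-variables and
each `hᵢ` using only `Z`-variables, then `maxrank(M_{fg}) ≤ r · maxrank(M_f)`. -/
theorem maxrank_mul_le_of_split_sum {F : Type} [Field F] {Y Z : Type} [Fintype Y] [Fintype Z]
    (f g : MvPolynomial (Y ⊕ Z) F) (r : ℕ)
    (gs hs : Fin r → MvPolynomial (Y ⊕ Z) F)
    (hgs : ∀ i, ∀ v ∈ (gs i).vars, v.isLeft = true)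
    (hhs : ∀ i, ∀ v ∈ (hs i).vars, v.isRight = true)
    (hg : g = ∑ i : Fin r, gs i * hs i) :
    PCM.maxrank (f * g) ≤ r * PCM.maxrank f := by
  refine ciSup_le fun S => ?_
  change (PCM.evalMatrix S (f * g)).rank ≤ _
  rw [hg, Finset.mul_sum, map_sum]
  calc _ ≤ ∑ i : Fin r, (PCM.evalMatrix S (f * (gs i * hs i))).rank := PCM.rank_sum_le _ _
    _ ≤ ∑ _i : Fin r, PCM.maxrank f := Finset.sum_le_sum fun i _ => by
      obtain ⟨R, hR⟩ := PCM.exists_evalMatrix_mul_left S (gs i) (hgs i)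
      obtain ⟨C, hC⟩ := PCM.exists_evalMatrix_mul_right S (hs i) (hhs i)
      rw [← mul_assoc, hC, hR]
      exact (Matrix.rank_mul_le_left _ _).trans
        ((Matrix.rank_mul_le_right _ _).trans (PCM.rank_evalMatrix_le_maxrank S f))
    _ = r * PCM.maxrank f := by simp
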